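/- arXiv:2511.17157 — 2 statements merged into one kernel-verified Lean document; each statement's English description precedes it below -/
import Mathlib

section
/- (Per-iteration telescoping inequality of GLALM with the specific parameter choice.) Let X ⊆ ℝⁿ be closed convex, f : ℝⁿ → ℝ convex differentiable with f(x') ≤ f(x) + ⟨∇f(x), x' − x⟩ + (L/2)‖x' − x‖² for all x, x' (L ≥ 0), g : ℝⁿ → ℝ convex, F = f + g, A an l × n real matrix, b ∈ ℝˡ. Let x* ∈ X satisfy A x* = b. Fix γ > 0, η > 0 with α := 2L/η ∈ (0, 1), and κ ∈ (1, 2). For k ≥ 1 set θ_k = 2/(k+1), γ_k = k γ, κ_k = κ γ k / 2, P^k = (η/k)·I. Given iterates x_ag^k, x̂^k ∈ ℝⁿ and ẑ^k ∈ ℝˡ, define x_md^k = (1 − θ_k) x_ag^k + θ_k x̂^k; x^{k+1} a minimizer over X of x ↦ ⟨∇f(x_md^k) − Aᵀ ẑ^k, x⟩ + g(x) + (κ_k/2)‖A x − b‖² + (1/(2))·(η/k)·‖x − x̂^k‖²; x̂^{k+1} = (α − 1) x̂^k + (2 − α) x^{k+1}; x_ag^{k+1} = (1 − θ_k) x_ag^k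 + θ_k x^{k+1}; z^{k+1} = ẑ^k − γ_k (A x^{k+1} − b); ẑ^{k+1} = (1 − κ) ẑ^k + κ z^{k+1}. Then for every z ∈ ℝˡ and every k ≥ 1: k(k+1)·(F(x_ag^{k+1}) − F(x*) − ⟨z, A x_ag^{k+1} − b⟩) − (k−1)k·(F(x_ag^k) − F(x*) − ⟨z, A x_ag^k − b⟩) ≤ (η/(2 − α))·(‖x̂^k − x*‖² − ‖x̂^{k+1} − x*‖²) + (1/(κ γ))·(‖ẑ^k − z‖² − ‖ẑ^{k+1} − z‖²). -/
open scoped RealInnerProductSpace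

section

variable {E V : Type*} [NormedAddCommGroup E] [InnerProductSpace ℝ E]
  [NormedAddCommGroup V] [InnerProductSpace ℝ V]

/-- First-order lower bound for a differentiable convex function. -/
theorem ConvexOn.add_inner_gradient_le [CompleteSpace E] {f : E → ℝ} {v x : E}
    (hf : ConvexOn ℝ Set.univ f) (hv : HasGradientAt f v x) (y : E) :
    f x + ⟪v, y - x⟫ ≤ f y := by
  have hline : HasDerivAt (fun t : ℝ => f (AffineMap.lineMap x y t)) ⟪v, y - x⟫ 0 := by
    have h1 : HasFDerivAt f (InnerProductSpace.toDual ℝ E v)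
        (AffineMap.lineMap x y (0 : ℝ)) := by
      simpa using hv.hasFDerivAt
    simpa [Function.comp_def] using h1.comp_hasDerivAt (0 : ℝ) AffineMap.hasDerivAt_lineMap
  have hconv : ConvexOn ℝ Set.univ (fun t : ℝ => f (AffineMap.lineMap x y t)) := by
    simpa [Function.comp_def] using hf.comp_affineMap (AffineMap.lineMap x y)
  have h := hconv.le_slope_of_hasDerivAt (Set.mem_univ 0) (Set.mem_univ 1) one_pos hline
  simp [slope_def_field] at h
  linarith

/-- Variational inequality satisfied by a minimizer of a convex function plus quadratic terms. -/
theorem variational_inequality_of_isMin {X : Set E} (hX : Convex ℝ X) {g : E → ℝ}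
    (hg : ConvexOn ℝ Set.univ g) (T : E →ₗ[ℝ] V) (b : V) (c p : E) {ρ σ : ℝ}
    {x y : E} (hx : x ∈ X) (hy : y ∈ X)
    (hmin : ∀ u ∈ X,
      ⟪c, x⟫ + g x + ρ / 2 * ‖T x - b‖ ^ 2 + σ / 2 * ‖x - p‖ ^ 2
        ≤ ⟪c, u⟫ + g u + ρ / 2 * ‖T u - b‖ ^ 2 + σ / 2 * ‖u - p‖ ^ 2) :
    ⟪c, x - y⟫ + g x - g y + ρ * ⟪T x - b, T (x - y)⟫ + σ * ⟪x - p, x - y⟫ ≤ 0 := by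
  set S := ⟪c, x - y⟫ + g x - g y + ρ * ⟪T x - b, T (x - y)⟫ + σ * ⟪x - p, x - y⟫ with hS
  set C := ρ / 2 * ‖T (x - y)‖ ^ 2 + σ / 2 * ‖x - y‖ ^ 2 with hC
  have key : ∀ t : ℝ, 0 < t → t ≤ 1 → S ≤ t * C := by
    intro t ht ht1
    have hmem : (1 - t) • x + t • y ∈ X := hX hx hy (by linarith) ht.le (by ring)
    have h := hmin _ hmem
    have hgt := hg.2 (Set.mem_univ x) (Set.mem_univ y) (by linarith : 0 ≤ 1 - t) ht.le (by ring)
    simp only [smul_eq_mul] at hgt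
    have e0 : (1 - t) • x + t • y = x - t • (x - y) := by module
    have e1 : T (x - t • (x - y)) - b = (T x - b) - t • T (x - y) := by
      rw [map_sub, map_smul]; abel
    have e2 : x - t • (x - y) - p = (x - p) - t • (x - y) := by abel
    rw [e0] at h hgt
    rw [e1, e2, norm_sub_sq_real (T x - b), norm_sub_sq_real (x - p), inner_sub_right,
      inner_smul_right, inner_smul_right, inner_smul_right, norm_smul, norm_smul, mul_pow, mul_pow,
      Real.norm_eq_abs, sq_abs] at h
    have : t * S ≤ t * (t * C) := by
      rw [hS, hC]; linarith
    exact le_of_mul_le_mul_left this ht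
  have hlim : Filter.Tendsto (fun t : ℝ => t * C) (nhdsWithin 0 (Set.Ioi 0)) (nhds 0) := by
    have : Filter.Tendsto (fun t : ℝ => t * C) (nhds 0) (nhds (0 * C)) :=
      Filter.tendsto_id.mul_const C
    rw [zero_mul] at this
    exact this.mono_left nhdsWithin_le_nhds
  refine ge_of_tendsto hlim ?_
  filter_upwards [Ioc_mem_nhdsGT (zero_lt_one' ℝ)] with t ht
  exact key t ht.1 ht.2

end

theorem glalm_per_iteration_telescoping {n l : ℕ}
    (X : Set (EuclideanSpace ℝ (Fin n))) (hXcl : IsClosed X) (hXcv : Convex ℝ X)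
    (f g : EuclideanSpace ℝ (Fin n) → ℝ)
    (f' : EuclideanSpace ℝ (Fin n) → EuclideanSpace ℝ (Fin n))
    (L : ℝ) (hL : 0 ≤ L)
    (hdiff : ∀ x, HasGradientAt f (f' x) x)
    (hfconv : ConvexOn ℝ Set.univ f)
    (hgconv : ConvexOn ℝ Set.univ g)
    (hsmooth : ∀ x x', f x' ≤ f x + ⟪f' x, x' - x⟫ + L / 2 * ‖x' - x‖ ^ 2)
    (A : Matrix (Fin l) (Fin n) ℝ) (b : EuclideanSpace ℝ (Fin l))
    (xstar : EuclideanSpace ℝ (Fin n)) (hstarX : xstar ∈ X)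
    (hstarfeas : Matrix.toEuclideanLin A xstar = b)
    (γ η κ : ℝ) (hγ : 0 < γ) (hη : 0 < η)
    (hα : 2 * L / η ∈ Set.Ioo (0 : ℝ) 1) (hκ : κ ∈ Set.Ioo (1 : ℝ) 2)
    (k : ℕ) (hk : 1 ≤ k)
    (xag xhat xmd xplus xhatp xagp : EuclideanSpace ℝ (Fin n))
    (zhat zplus zhatp : EuclideanSpace ℝ (Fin l))
    (hmd : xmd = (1 - 2 / ((k : ℝ) + 1)) • xag + (2 / ((k : ℝ) + 1)) • xhat)
    (hplusX : xplus ∈ X)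
    (hplusmin : ∀ x ∈ X,
      ⟪f' xmd - Matrix.toEuclideanLin A.transpose zhat, xplus⟫ + g xplus
          + (κ * γ * (k : ℝ) / 2) / 2 * ‖Matrix.toEuclideanLin A xplus - b‖ ^ 2
          + η / (2 * (k : ℝ)) * ‖xplus - xhat‖ ^ 2
        ≤ ⟪f' xmd - Matrix.toEuclideanLin A.transpose zhat, x⟫ + g x
          + (κ * γ * (k : ℝ) / 2) / 2 * ‖Matrix.toEuclideanLin A x - b‖ ^ 2
          + η / (2 * (k : ℝ)) * ‖x - xhat‖ ^ 2)
    (hhatp : xhatp = (2 * L / η - 1) • xhat + (2 - 2 * L / η) • xplus)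
    (hagp : xagp = (1 - 2 / ((k : ℝ) + 1)) • xag + (2 / ((k : ℝ) + 1)) • xplus)
    (hz : zplus = zhat - ((k : ℝ) * γ) • (Matrix.toEuclideanLin A xplus - b))
    (hzhatp : zhatp = (1 - κ) • zhat + κ • zplus) :
    ∀ z : EuclideanSpace ℝ (Fin l),
      (k : ℝ) * ((k : ℝ) + 1)
          * ((f xagp + g xagp) - (f xstar + g xstar)
              - ⟪z, Matrix.toEuclideanLin A xagp - b⟫)
        - ((k : ℝ) - 1) * (k : ℝ)
          * ((f xag + g xag) - (f xstar + g xstar)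
              - ⟪z, Matrix.toEuclideanLin A xag - b⟫)
      ≤ η / (2 - 2 * L / η) * (‖xhat - xstar‖ ^ 2 - ‖xhatp - xstar‖ ^ 2)
        + 1 / (κ * γ) * (‖zhat - z‖ ^ 2 - ‖zhatp - z‖ ^ 2) := by
  intro z
  obtain ⟨hα0, hα1⟩ := hα
  have hκ0 : 0 < κ := by linarith [hκ.1]
  have hk1 : (1 : ℝ) ≤ k := by exact_mod_cast hk
  set K : ℝ := (k : ℝ)
  have hKpos : 0 < K := by linarith
  set T := Matrix.toEuclideanLin A
  have hadj : ∀ u, ⟪Matrix.toEuclideanLin A.transpose zhat, u⟫ = ⟪zhat, T u⟫ := by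
    intro u
    rw [← Matrix.conjTranspose_eq_transpose_of_trivial,
      Matrix.toEuclideanLin_conjTranspose_eq_adjoint, LinearMap.adjoint_inner_left]
  have hr : T (xplus - xstar) = T xplus - b := by rw [map_sub, hstarfeas]
  have hvar := variational_inequality_of_isMin hXcv hgconv T b
    (f' xmd - Matrix.toEuclideanLin A.transpose zhat) xhat (ρ := κ * γ * K / 2) (σ := η / K)
    hplusX hstarX (by
      have : η / K / 2 = η / (2 * K) := by field_simp
      rw [this]; exact hplusmin)
  rw [inner_sub_left, hadj, hr, real_inner_self_eq_norm_sq] at hvar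
  set θ : ℝ := 2 / (K + 1) with hθ
  have hθ0 : 0 ≤ θ := by positivity
  have hθ1 : 0 ≤ 1 - θ := by
    rw [hθ, sub_nonneg, div_le_one (by linarith)]; linarith
  have hKθ : K * (K + 1) * θ = 2 * K := by rw [hθ]; field_simp
  have hKθ' : K * (K + 1) * (1 - θ) = (K - 1) * K := by linear_combination -hKθ
  have hf1 := hfconv.add_inner_gradient_le (hdiff xmd) xag
  have hf2 := hfconv.add_inner_gradient_le (hdiff xmd) xstar
  have hf3 := hsmooth xmd xagp
  have hg1 := hgconv.2 (Set.mem_univ xag) (Set.mem_univ xplus) hθ1 hθ0 (by ring)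
  rw [← hagp, smul_eq_mul, smul_eq_mul] at hg1
  have estep : xagp - xmd = θ • (xplus - xhat) := by rw [hagp, hmd]; module
  have esplit : xagp - xmd
      = (1 - θ) • (xag - xmd) + θ • (xstar - xmd) + θ • (xplus - xstar) := by
    rw [hagp]; module
  have einner : ⟪f' xmd, xagp - xmd⟫ = (1 - θ) * ⟪f' xmd, xag - xmd⟫
      + θ * ⟪f' xmd, xstar - xmd⟫ + θ * ⟪f' xmd, xplus - xstar⟫ := by
    rw [esplit, inner_add_right, inner_add_right, inner_smul_right, inner_smul_right,
      inner_smul_right]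
  have eres : ⟪z, T xagp - b⟫ = (1 - θ) * ⟪z, T xag - b⟫ + θ * ⟪z, T xplus - b⟫ := by
    have : T xagp - b = (1 - θ) • (T xag - b) + θ • (T xplus - b) := by
      rw [hagp, map_add, map_smul, map_smul]; module
    rw [this, inner_add_right, inner_smul_right, inner_smul_right]
  rw [einner, estep, norm_smul, mul_pow, Real.norm_eq_abs, sq_abs] at hf3
  have hF : f xagp + g xagp ≤ (1 - θ) * (f xag + g xag)
      + θ * (f xstar + ⟪f' xmd, xplus - xstar⟫ + g xplus)
      + L / 2 * (θ ^ 2 * ‖xplus - xhat‖ ^ 2) := by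
    linarith [mul_le_mul_of_nonneg_left hf1 hθ1, mul_le_mul_of_nonneg_left hf2 hθ0]
  have hdual : 1 / (κ * γ) * (‖zhat - z‖ ^ 2 - ‖zhatp - z‖ ^ 2)
      = 2 * K * ⟪zhat - z, T xplus - b⟫ - κ * γ * K ^ 2 * ‖T xplus - b‖ ^ 2 := by
    have : zhatp - z = (zhat - z) - (κ * (K * γ)) • (T xplus - b) := by
      rw [hzhatp, hz]; module
    rw [this, norm_sub_sq_real (zhat - z), inner_smul_right, norm_smul, mul_pow, Real.norm_eq_abs,
      sq_abs]
    field_simp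
    ring
  have hprimal : η / (2 - 2 * L / η) * (‖xhat - xstar‖ ^ 2 - ‖xhatp - xstar‖ ^ 2)
      = 2 * L * ‖xplus - xhat‖ ^ 2 - 2 * η * ⟪xplus - xhat, xplus - xstar⟫ := by
    have hLα : 2 * L = 2 * L / η * η := by field_simp
    set α := 2 * L / η
    have h2α : 2 - α ≠ 0 := by linarith
    have e1 : xhat - xstar = (xplus - xstar) - (xplus - xhat) := by abel
    have e2 : xhatp - xstar = (xplus - xstar) + (1 - α) • (xplus - xhat) := by
      rw [hhatp]; module
    rw [e2, e1, norm_sub_sq_real, norm_add_sq_real, inner_smul_right, norm_smul, mul_pow,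
      Real.norm_eq_abs, sq_abs, real_inner_comm (xplus - xstar), hLα]
    field_simp
    ring
  have hquad : K * (K + 1) * (L / 2 * (θ ^ 2 * ‖xplus - xhat‖ ^ 2))
      ≤ 2 * L * ‖xplus - xhat‖ ^ 2 := by
    have e : K * (K + 1) * (L / 2 * (θ ^ 2 * ‖xplus - xhat‖ ^ 2))
        = K * θ * (L * ‖xplus - xhat‖ ^ 2) := by
      linear_combination (L / 2 * θ * ‖xplus - xhat‖ ^ 2) * hKθ
    have hle : K * θ ≤ 2 := by
      rw [hθ, mul_div_assoc', div_le_iff₀ (by linarith)]; linarith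
    rw [e, mul_assoc 2 L]
    exact mul_le_mul_of_nonneg_right hle (by positivity)
  have hvar2 : 2 * K * (⟪f' xmd, xplus - xstar⟫ + g xplus - g xstar)
      ≤ 2 * K * ⟪zhat, T xplus - b⟫ - κ * γ * K ^ 2 * ‖T xplus - b‖ ^ 2
        - 2 * η * ⟪xplus - xhat, xplus - xstar⟫ := by
    have h := mul_le_mul_of_nonneg_left hvar (by linarith : 0 ≤ 2 * K)
    have e : K * (η / K) = η := by field_simp
    linear_combination h - 2 * ⟪xplus - xhat, xplus - xstar⟫ * e
  have hF2 := mul_le_mul_of_nonneg_left hF (by positivity : 0 ≤ K * (K + 1))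
  rw [hprimal, hdual, eres, inner_sub_left zhat]
  linear_combination hF2 + hquad + hvar2
    + (f xag + g xag - ⟪z, T xag - b⟫ - (f xstar + g xstar)) * hKθ'
    + (f xstar + ⟪f' xmd, xplus - xstar⟫ + g xplus - ⟪z, T xplus - b⟫
      - (f xstar + g xstar)) * hKθ
end

section
/- (Convergence rate of GLADMM.) Let X ⊆ ℝⁿ, Y ⊆ ℝᵐ be closed convex, f : ℝⁿ → ℝ convex differentiable with f(x') ≤ f(x) + ⟨∇f(x), x' − x⟩ + (L/2)‖x' − x‖² for all x, x' (L ≥ 0), g : ℝᵐ → ℝ convex, A ∈ ℝ^{l×n}, B ∈ ℝ^{l×m}, b ∈ ℝˡ. Let (x*, y*, z*) be a saddle point: x* ∈ X, y* ∈ Y, B y* − A x* = b, and f(x) + g(y) − ⟨z*, B y − A x − b⟩ ≥ f(x*) + g(y*) for all x ∈ X, y ∈ Y. Fix N ≥ 2, γ > 0, α ∈ (0, 1), ξ ∈ [1.5, 2), β = 1/ξ, κ > 1, and run GLADMM for N − 1 iterations with θ_k = 2/(k+1), λ_k = τ_k = γN/k, γ_k = (2 − ξ)γk/(κN), η_k =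 2L/(αk), from x¹ = x̂¹ = x_ag¹ ∈ X, y¹ = ŷ¹ = y_ag¹ ∈ Y with B y¹ = A x¹ + b, and z¹ = ẑ¹ = z_ag¹ = 0. Write F(x, y) = f(x) + g(y) and C(N) = (2L‖x¹ − x*‖²)/(α(2 − α)N(N − 1)) + κ·max{(1 + ‖z*‖)², 4‖z*‖²}/(γ(2 − ξ)(N − 1)) + (2γ‖B y¹ − B y*‖²)/((2 − β)(N − 1)). Then |F(x_ag^N, y_ag^N) − F(x*, y*)| ≤ C(N) and ‖B y_ag^N − A x_ag^N − b‖ ≤ C(N). -/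
open scoped RealInnerProductSpace

/-- A function `t ↦ t * a + t ^ 2 * c` that is nonnegative on `(0, 1]` has nonnegative slope at
the origin. -/
theorem nonneg_of_forall_mul_add_sq_mul_nonneg {a c : ℝ}
    (h : ∀ t : ℝ, 0 < t → t ≤ 1 → 0 ≤ t * a + t ^ 2 * c) : 0 ≤ a := by
  by_contra! ha
  have hd : 0 < |c| - a := by linarith [abs_nonneg c]
  have ht : 0 < -a / (|c| - a) := div_pos (by linarith) hd
  have ht1 : -a / (|c| - a) ≤ 1 := by
    rw [div_le_one hd]; linarith [abs_nonneg c]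
  have key := h _ ht ht1
  have hmul : -a / (|c| - a) * (|c| - a) = -a := div_mul_cancel₀ _ hd.ne'
  generalize -a / (|c| - a) = t at *
  have h1 : 0 ≤ a + t * c := by
    by_contra! hneg
    nlinarith [mul_pos ht (neg_pos.mpr hneg)]
  nlinarith [mul_le_mul_of_nonneg_left (le_abs_self c) ht.le, mul_pos ht (neg_pos.mpr ha)]

section

variable {E F G : Type*} [NormedAddCommGroup E] [InnerProductSpace ℝ E]
  [NormedAddCommGroup F] [InnerProductSpace ℝ F]
  [NormedAddCommGroup G] [InnerProductSpace ℝ G]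

theorem norm_add_smul_sq (t : ℝ) (u v : E) :
    ‖u + t • v‖ ^ 2 = ‖u‖ ^ 2 + 2 * t * ⟪u, v⟫ + t ^ 2 * ‖v‖ ^ 2 := by
  rw [norm_add_sq_real, inner_smul_right, norm_smul, mul_pow, Real.norm_eq_abs, sq_abs]
  ring

/-- First-order optimality condition for a convex function plus two quadratic terms. -/
theorem variational_inequality_of_isMinOn {X : Set E} (hX : Convex ℝ X) {h : E → ℝ}
    (hh : ConvexOn ℝ Set.univ h) (M : E →ₗ[ℝ] G) (d : G) (c : E) (lam η : ℝ) {p : E}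
    (hp : p ∈ X)
    (hmin : ∀ u ∈ X, h p + lam / 2 * ‖M p - d‖ ^ 2 + η / 2 * ‖p - c‖ ^ 2
      ≤ h u + lam / 2 * ‖M u - d‖ ^ 2 + η / 2 * ‖u - c‖ ^ 2)
    {u : E} (hu : u ∈ X) :
    0 ≤ h u - h p + lam * ⟪M p - d, M (u - p)⟫ + η * ⟪p - c, u - p⟫ := by
  refine nonneg_of_forall_mul_add_sq_mul_nonneg
    (c := lam / 2 * ‖M (u - p)‖ ^ 2 + η / 2 * ‖u - p‖ ^ 2) fun t ht0 ht1 => ?_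
  have hmem := hX.add_smul_sub_mem hp hu ⟨ht0.le, ht1⟩
  have h1 := hmin _ hmem
  have h2 : h (p + t • (u - p)) ≤ (1 - t) * h p + t * h u := by
    have := hh.2 (Set.mem_univ p) (Set.mem_univ u) (sub_nonneg.mpr ht1) ht0.le (by ring)
    rwa [show (1 - t) • p + t • u = p + t • (u - p) by module] at this
  have h3 : M (p + t • (u - p)) - d = (M p - d) + t • M (u - p) := by
    rw [map_add, map_smul]; abel
  have h4 : p + t • (u - p) - c = (p - c) + t • (u - p) := by abel
  rw [h3, h4, norm_add_smul_sq, norm_add_smul_sq] at h1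
  linarith

/-- Gradient inequality for differentiable convex functions. -/
theorem ConvexOn.add_inner_le_of_hasGradientAt [CompleteSpace E] {f : E → ℝ} {f' x : E}
    (hf : ConvexOn ℝ Set.univ f) (hx : HasGradientAt f f' x) (u : E) :
    f x + ⟪f', u - x⟫ ≤ f u := by
  have hline : ConvexOn ℝ Set.univ (fun t : ℝ => f (AffineMap.lineMap x u t)) :=
    hf.comp_affineMap (AffineMap.lineMap x u)
  have hder : HasDerivAt (fun t : ℝ => f (AffineMap.lineMap x u t)) ⟪f', u - x⟫ 0 := by
    have hx' : HasFDerivAt f (InnerProductSpace.toDual ℝ E f') (AffineMap.lineMap x u (0 : ℝ)) := by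
      simpa using hx.hasFDerivAt
    exact hx'.comp_hasDerivAt (0 : ℝ) AffineMap.hasDerivAt_lineMap
  have := hline.le_slope_of_hasDerivAt (Set.mem_univ 0) (Set.mem_univ 1) zero_lt_one hder
  simp only [slope_def_field, AffineMap.lineMap_apply_one, AffineMap.lineMap_apply_zero,
    sub_zero, div_one] at this
  linarith

/-- Three-point identity for the over-relaxed update `q' = (2 - a) p + (a - 1) q`. -/
theorem inner_sub_of_overrelaxation {a : ℝ} {p q q' : E}
    (hq' : q' = (2 - a) • p + (a - 1) • q) (u : E) :
    2 * (2 - a) * ⟪p - q, u - p⟫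
      = ‖q - u‖ ^ 2 - ‖q' - u‖ ^ 2 - (2 - a) * a * ‖p - q‖ ^ 2 := by
  have h1 : q' - u = (q - u) + (2 - a) • (p - q) := by rw [hq']; module
  have h2 : u - p = -(q - u) - (p - q) := by abel
  rw [h1, norm_add_smul_sq, h2, inner_sub_right, inner_neg_right, real_inner_self_eq_norm_sq,
    real_inner_comm (p - q) (q - u)]
  ring

/-- One accelerated gradient step for a smooth convex function. -/
theorem accelerated_descent [CompleteSpace E] {f : E → ℝ} {f' : E → E} {L : ℝ}
    (hdiff : ∀ x, HasGradientAt f (f' x) x) (hf : ConvexOn ℝ Set.univ f)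
    (hsmooth : ∀ x x', f x' ≤ f x + ⟪f' x, x' - x⟫ + L / 2 * ‖x' - x‖ ^ 2)
    {θ : ℝ} (hθ0 : 0 ≤ θ) (hθ1 : θ ≤ 1) {xag xhat xmd p xag' : E}
    (hmd : xmd = (1 - θ) • xag + θ • xhat) (hag : xag' = (1 - θ) • xag + θ • p) (u : E) :
    f xag' ≤ (1 - θ) * f xag + θ * (f u + ⟪f' xmd, p - u⟫) + L / 2 * θ ^ 2 * ‖p - xhat‖ ^ 2 := by
  have h1 := hsmooth xmd xag'
  have h2 := mul_le_mul_of_nonneg_left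
    (hf.add_inner_le_of_hasGradientAt (hdiff xmd) xag) (sub_nonneg.mpr hθ1)
  have h3 := mul_le_mul_of_nonneg_left (hf.add_inner_le_of_hasGradientAt (hdiff xmd) u) hθ0
  have h4 : xag' - xmd = θ • (p - xhat) := by rw [hag, hmd]; module
  have h5 : xag' - xmd = (1 - θ) • (xag - xmd) + θ • (u - xmd) + θ • (p - u) := by
    rw [hag]; module
  have h6 : ‖xag' - xmd‖ ^ 2 = θ ^ 2 * ‖p - xhat‖ ^ 2 := by
    rw [h4, norm_smul, mul_pow, Real.norm_eq_abs, sq_abs]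
  rw [h6, h5, inner_add_right, inner_add_right, inner_smul_right, inner_smul_right,
    inner_smul_right] at h1
  linarith

/-- Algebraic bound on the coupling between the primal residual `r`, the shifted points
`p = B y⁺`, `q = B ŷ`, `s = B y*`, and the multiplier. -/
theorem coupling_bound {ξ β γ k N : ℝ} (hξ : 0 < ξ) (hξ2 : ξ < 2) (hβ : β = 1 / ξ)
    (hβ2 : β < 2) (hγ : 0 < γ) (hk : 0 < k) (hkN : k ≤ N) {p q q' s r zh zh' : G} (z : G)
    (hq' : q' = (2 - β) • p + (β - 1) • q)
    (hzh' : zh' = zh - ((2 - ξ) * γ * k / N) • r) :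
    2 * k * (⟪zh - z, r⟫
        + γ * N / k * (⟪q - p + r, (p - s) - r⟫ - ⟪r, p - s⟫))
      ≤ N / ((2 - ξ) * γ) * (‖zh - z‖ ^ 2 - ‖zh' - z‖ ^ 2)
        + γ * N / (2 - β) * (‖q - s‖ ^ 2 - ‖q' - s‖ ^ 2) := by
  have hN : 0 < N := hk.trans_le hkN
  have h1 := inner_sub_of_overrelaxation hq' s
  have hz1 : zh' - z = (zh - z) + (-((2 - ξ) * γ * k / N)) • r := by rw [hzh']; module
  have hz2 : N / ((2 - ξ) * γ) * (‖zh - z‖ ^ 2 - ‖zh' - z‖ ^ 2)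
      = 2 * k * ⟪zh - z, r⟫ - (2 - ξ) * γ * k ^ 2 / N * ‖r‖ ^ 2 := by
    have : 2 - ξ ≠ 0 := by linarith
    rw [hz1, norm_add_smul_sq]
    field_simp
    ring
  have hq2 : γ * N / (2 - β) * (‖q - s‖ ^ 2 - ‖q' - s‖ ^ 2)
      = γ * N * (2 * ⟪p - q, s - p⟫ + β * ‖p - q‖ ^ 2) := by
    have : 2 - β ≠ 0 := by linarith
    field_simp
    linarith
  have hc : ⟪q - p + r, (p - s) - r⟫ - ⟪r, p - s⟫
      = ⟪p - q, s - p⟫ + ⟪p - q, r⟫ - ‖r‖ ^ 2 := by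
    rw [← real_inner_self_eq_norm_sq]
    simp only [inner_add_left, inner_sub_left, inner_sub_right]
    ring
  have hr : 2 * ⟪p - q, r⟫ ≤ β * ‖p - q‖ ^ 2 + ξ * ‖r‖ ^ 2 := by
    have h := sq_nonneg ‖(p - q) + (-ξ) • r‖
    rw [norm_add_smul_sq] at h
    have hβξ : β * ξ = 1 := by rw [hβ]; field_simp
    have : 0 ≤ β * (‖p - q‖ ^ 2 + 2 * -ξ * ⟪p - q, r⟫ + (-ξ) ^ 2 * ‖r‖ ^ 2) :=
      mul_nonneg (by rw [hβ]; positivity) h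
    linear_combination this + (-2 * ⟪p - q, r⟫ + ξ * ‖r‖ ^ 2) * hβξ
  have hkk : k ^ 2 / N ≤ N := by
    rw [div_le_iff₀ hN]; nlinarith
  have hrr : (2 - ξ) * γ * k ^ 2 / N * ‖r‖ ^ 2 ≤ (2 - ξ) * γ * N * ‖r‖ ^ 2 := by
    rw [mul_div_assoc]
    have : 0 ≤ (2 - ξ) * γ := mul_nonneg (by linarith) hγ.le
    gcongr
  have hr' := mul_le_mul_of_nonneg_left hr (mul_nonneg hγ.le hN.le)
  have hexp : 2 * k * (⟪zh - z, r⟫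
        + γ * N / k * (⟪q - p + r, (p - s) - r⟫ - ⟪r, p - s⟫))
      = 2 * k * ⟪zh - z, r⟫ + 2 * (γ * N) * (⟪q - p + r, (p - s) - r⟫ - ⟪r, p - s⟫) := by
    field_simp
  rw [hexp, hc, hz2, hq2]
  linarith

/-- Decrease of the weighted Lyapunov function along one iteration of GLADMM. -/
theorem gladmm_step [CompleteSpace E] {X : Set E} (hX : Convex ℝ X) {Y : Set F}
    (hY : Convex ℝ Y) {f : E → ℝ} {g : F → ℝ} {f' : E → E} {L : ℝ} (hL : 0 ≤ L)
    (hdiff : ∀ x, HasGradientAt f (f' x) x) (hf : ConvexOn ℝ Set.univ f)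
    (hg : ConvexOn ℝ Set.univ g)
    (hsmooth : ∀ x x', f x' ≤ f x + ⟪f' x, x' - x⟫ + L / 2 * ‖x' - x‖ ^ 2)
    (A : E →ₗ[ℝ] G) (B : F →ₗ[ℝ] G) {b : G} {xs : E} {ys : F} (hxs : xs ∈ X) (hys : ys ∈ Y)
    (hfeas : B ys - A xs = b) {γ α ξ β k N : ℝ} (hγ : 0 < γ) (hα : 0 < α) (hα2 : α < 2)
    (hξ : 0 < ξ) (hξ2 : ξ < 2) (hβ : β = 1 / ξ) (hβ2 : β < 2) (hk : 1 ≤ k) (hkN : k ≤ N)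
    {p xh xh' xag xag' xmd : E} {q yh yh' yag yag' : F} {zh zh' : G} (z : G)
    (hmd : xmd = (1 - 2 / (k + 1)) • xag + (2 / (k + 1)) • xh) (hp : p ∈ X)
    (hpmin : ∀ u ∈ X, ⟪f' xmd, p⟫ + (γ * N / k) / 2 * ‖B yh - A p - b‖ ^ 2 + ⟪zh, A p⟫
        + (2 * L / (α * k)) / 2 * ‖p - xh‖ ^ 2
      ≤ ⟪f' xmd, u⟫ + (γ * N / k) / 2 * ‖B yh - A u - b‖ ^ 2 + ⟪zh, A u⟫
        + (2 * L / (α * k)) / 2 * ‖u - xh‖ ^ 2)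
    (hxh' : xh' = (2 - α) • p + (α - 1) • xh)
    (hxag' : xag' = (1 - 2 / (k + 1)) • xag + (2 / (k + 1)) • p) (hq : q ∈ Y)
    (hqmin : ∀ u ∈ Y, g q - ⟪zh, B q⟫ + (γ * N / k) / 2 * ‖B q - A p - b‖ ^ 2
      ≤ g u - ⟪zh, B u⟫ + (γ * N / k) / 2 * ‖B u - A p - b‖ ^ 2)
    (hyh' : yh' = (2 - β) • q + (β - 1) • yh)
    (hyag' : yag' = (1 - 2 / (k + 1)) • yag + (2 / (k + 1)) • q)
    (hzh' : zh' = zh - ((2 - ξ) * γ * k / N) • (B q - A p - b)) :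
    (k + 1) * k * (f xag' + g yag' - (f xs + g ys) - ⟪z, B yag' - A xag' - b⟫)
        + 2 * L / (α * (2 - α)) * ‖xh' - xs‖ ^ 2 + γ * N / (2 - β) * ‖B yh' - B ys‖ ^ 2
        + N / ((2 - ξ) * γ) * ‖zh' - z‖ ^ 2
      ≤ k * (k - 1) * (f xag + g yag - (f xs + g ys) - ⟪z, B yag - A xag - b⟫)
        + 2 * L / (α * (2 - α)) * ‖xh - xs‖ ^ 2 + γ * N / (2 - β) * ‖B yh - B ys‖ ^ 2
        + N / ((2 - ξ) * γ) * ‖zh - z‖ ^ 2 := by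
  have hk0 : 0 < k := by linarith
  have hθ0 : 0 ≤ 2 / (k + 1) := by positivity
  have hθ1 : 2 / (k + 1) ≤ 1 := by rw [div_le_one (by linarith)]; linarith
  have hfd := accelerated_descent hdiff hf hsmooth hθ0 hθ1 hmd hxag' xs
  have hgd : g yag' ≤ (1 - 2 / (k + 1)) * g yag + 2 / (k + 1) * g q := by
    rw [hyag']
    exact hg.2 (Set.mem_univ _) (Set.mem_univ _) (sub_nonneg.mpr hθ1) hθ0 (by ring)
  have hrd : ⟪z, B yag' - A xag' - b⟫ = (1 - 2 / (k + 1)) * ⟪z, B yag - A xag - b⟫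
      + 2 / (k + 1) * ⟪z, B q - A p - b⟫ := by
    rw [← inner_smul_right, ← inner_smul_right, ← inner_add_right, hyag', hxag']
    simp only [map_add, map_smul]
    congr 1
    module
  have hlin : ConvexOn ℝ Set.univ fun u : E => ⟪f' xmd, u⟫ + ⟪zh, A u⟫ :=
    (((innerₗ E (f' xmd)).convexOn convex_univ).add
      (((innerₗ G zh).comp A).convexOn convex_univ))
  have hxopt := variational_inequality_of_isMinOn hX hlin A (B yh - b) xh (γ * N / k)
    (2 * L / (α * k)) hp (fun u hu => by
      have := hpmin u hu
      rw [sub_right_comm, norm_sub_rev, sub_right_comm _ (A u), norm_sub_rev _ (A u)] at this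
      linarith) hxs
  have hgl : ConvexOn ℝ Set.univ fun u : F => g u + ⟪-zh, B u⟫ :=
    hg.add (((innerₗ G (-zh)).comp B).convexOn convex_univ)
  have hyopt := variational_inequality_of_isMinOn hY hgl B (A p + b) q (γ * N / k) 0 hq
    (fun u hu => by
      have := hqmin u hu
      simp only [inner_neg_left, ← sub_sub]
      linarith) hys
  have hrelax := inner_sub_of_overrelaxation hxh' xs
  have hcoup := coupling_bound hξ hξ2 hβ hβ2 hγ hk0 hkN (p := B q) (q := B yh) (q' := B yh')
    (s := B ys) (zh := zh) (zh' := zh') z (by rw [hyh']; simp only [map_add, map_smul]) hzh'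
  have hAp : A xs - A p = -((B q - B ys) - (B q - A p - b)) := by rw [← hfeas]; abel
  have hres : A p - (B yh - b) = -(B yh - B q + (B q - A p - b)) := by abel
  have hsum : g q - g ys + ⟪f' xmd, p - xs⟫ - ⟪z, B q - A p - b⟫
      ≤ ⟪zh - z, B q - A p - b⟫
        + γ * N / k * (⟪B yh - B q + (B q - A p - b), (B q - B ys) - (B q - A p - b)⟫
          - ⟪B q - A p - b, B q - B ys⟫)
        + 2 * L / (α * k) * ⟪p - xh, xs - p⟫ := by
    have hys' : B (ys - q) = -(B q - B ys) := by rw [map_sub]; abel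
    have e1 : ⟪zh, A xs⟫ - ⟪zh, A p⟫ = ⟪zh, B q - A p - b⟫ - ⟪zh, B q⟫ + ⟪zh, B ys⟫ := by
      rw [← inner_sub_right, hAp]
      simp only [inner_neg_right, inner_sub_right]
      ring
    rw [hres, map_sub, hAp, inner_neg_neg] at hxopt
    rw [hys', inner_neg_right, inner_neg_left, inner_neg_left, ← sub_sub (B q)] at hyopt
    rw [inner_sub_right (f' xmd), inner_sub_left zh z]
    linarith
  have hgrad : 2 * k * (2 * L / (α * k) * ⟪p - xh, xs - p⟫)
      = 2 * L / (α * (2 - α)) * (‖xh - xs‖ ^ 2 - ‖xh' - xs‖ ^ 2)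
        - 2 * L * ‖p - xh‖ ^ 2 := by
    have : 2 - α ≠ 0 := by linarith
    field_simp
    linear_combination L * hrelax
  have hkey := mul_le_mul_of_nonneg_left hsum (show 0 ≤ 2 * k by positivity)
  have hfd' := mul_le_mul_of_nonneg_left (add_le_add hfd hgd)
    (show 0 ≤ (k + 1) * k by positivity)
  have hquad : (k + 1) * k * (L / 2 * (2 / (k + 1)) ^ 2 * ‖p - xh‖ ^ 2)
      ≤ 2 * L * ‖p - xh‖ ^ 2 := by
    have : (k + 1) * k * (L / 2 * (2 / (k + 1)) ^ 2 * ‖p - xh‖ ^ 2)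
        = k / (k + 1) * (2 * L * ‖p - xh‖ ^ 2) := by field_simp
    rw [this]
    exact mul_le_of_le_one_left (by positivity) (by rw [div_le_one (by linarith)]; linarith)
  have hw0 : (k + 1) * k * (2 / (k + 1)) = 2 * k := by field_simp
  rw [hrd]
  linear_combination hfd' + hkey + hcoup + hquad + hgrad
    + (f xs + ⟪f' xmd, p - xs⟫ + g q - ⟪z, B q - A p - b⟫
      - (f xag + g yag - ⟪z, B yag - A xag - b⟫)) * hw0

end

/-- Passing from a bound on the perturbed gap function, for all multipliers, to bounds on the
objective value and on the primal residual. -/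
theorem abs_le_and_norm_le_of_gap_le {G : Type*} [NormedAddCommGroup G] [InnerProductSpace ℝ G]
    {v K c : ℝ} (hc : 0 ≤ c) {r zs : G} (hs : ⟪zs, r⟫ ≤ v)
    (hgap : ∀ z : G, v - ⟪z, r⟫ ≤ K + c * ‖z‖ ^ 2) :
    |v| ≤ K + c * max ((1 + ‖zs‖) ^ 2) (4 * ‖zs‖ ^ 2) ∧
      ‖r‖ ≤ K + c * max ((1 + ‖zs‖) ^ 2) (4 * ‖zs‖ ^ 2) := by
  have h0 := hgap 0
  have h2 := hgap ((2 : ℝ) • zs)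
  have h1 := hgap (zs - ‖r‖⁻¹ • r)
  have hm1 := mul_le_mul_of_nonneg_left (le_max_left ((1 + ‖zs‖) ^ 2) (4 * ‖zs‖ ^ 2)) hc
  have hm2 := mul_le_mul_of_nonneg_left (le_max_right ((1 + ‖zs‖) ^ 2) (4 * ‖zs‖ ^ 2)) hc
  have hcz : 0 ≤ c * (4 * ‖zs‖ ^ 2) := by positivity
  simp only [inner_zero_left, norm_zero] at h0
  rw [inner_smul_left, norm_smul, mul_pow] at h2
  norm_num at h2
  have hn : ‖zs - ‖r‖⁻¹ • r‖ ≤ 1 + ‖zs‖ := by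
    have hunit : ‖‖r‖⁻¹ • r‖ ≤ 1 := by
      rw [norm_smul, norm_inv, norm_norm]
      exact inv_mul_le_one
    linarith [norm_sub_le zs (‖r‖⁻¹ • r)]
  have hn2 := mul_le_mul_of_nonneg_left (pow_le_pow_left₀ (norm_nonneg _) hn 2) hc
  have hr : ⟪‖r‖⁻¹ • r, r⟫ = ‖r‖ := by
    rw [real_inner_smul_left, real_inner_self_eq_norm_sq, pow_two, ← mul_assoc]
    exact inv_mul_mul_self _
  rw [inner_sub_left, hr] at h1
  exact ⟨abs_le.mpr ⟨by linarith, by linarith⟩, by linarith⟩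

theorem gladmm_convergence_rate {n m l : ℕ}
    (X : Set (EuclideanSpace ℝ (Fin n))) (hXcl : IsClosed X) (hXcv : Convex ℝ X)
    (Y : Set (EuclideanSpace ℝ (Fin m))) (hYcl : IsClosed Y) (hYcv : Convex ℝ Y)
    (f : EuclideanSpace ℝ (Fin n) → ℝ) (g : EuclideanSpace ℝ (Fin m) → ℝ)
    (f' : EuclideanSpace ℝ (Fin n) → EuclideanSpace ℝ (Fin n))
    (L : ℝ) (hL : 0 ≤ L)
    (hdiff : ∀ x, HasGradientAt f (f' x) x)
    (hfconv : ConvexOn ℝ Set.univ f)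
    (hgconv : ConvexOn ℝ Set.univ g)
    (hsmooth : ∀ x x', f x' ≤ f x + ⟪f' x, x' - x⟫ + L / 2 * ‖x' - x‖ ^ 2)
    (A : Matrix (Fin l) (Fin n) ℝ) (B : Matrix (Fin l) (Fin m) ℝ)
    (b : EuclideanSpace ℝ (Fin l))
    (xstar : EuclideanSpace ℝ (Fin n)) (ystar : EuclideanSpace ℝ (Fin m))
    (zstar : EuclideanSpace ℝ (Fin l))
    (hstarX : xstar ∈ X) (hstarY : ystar ∈ Y)
    (hstarfeas : Matrix.toEuclideanLin B ystar - Matrix.toEuclideanLin A xstar = b)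
    (hsaddle : ∀ x' ∈ X, ∀ y' ∈ Y,
      f xstar + g ystar
        ≤ f x' + g y'
          - ⟪zstar, Matrix.toEuclideanLin B y' - Matrix.toEuclideanLin A x' - b⟫)
    (N : ℕ) (hN : 2 ≤ N)
    (γ α ξ β κ : ℝ) (hγ : 0 < γ) (hα : α ∈ Set.Ioo (0 : ℝ) 1)
    (hξ : ξ ∈ Set.Ico (1.5 : ℝ) 2) (hβ : β = 1 / ξ) (hκ : 1 < κ)
    (x xhat xag xmd : ℕ → EuclideanSpace ℝ (Fin n))
    (y yhat yag : ℕ → EuclideanSpace ℝ (Fin m))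
    (z zhat zag : ℕ → EuclideanSpace ℝ (Fin l))
    (hinitX : x 1 ∈ X) (hinitx1 : x 1 = xhat 1) (hinitx2 : x 1 = xag 1)
    (hinitY : y 1 ∈ Y) (hinity1 : y 1 = yhat 1) (hinity2 : y 1 = yag 1)
    (hinitfeas : Matrix.toEuclideanLin B (y 1) = Matrix.toEuclideanLin A (x 1) + b)
    (hinitz : z 1 = 0) (hinitzhat : zhat 1 = 0) (hinitzag : zag 1 = 0)
    (hmd : ∀ k : ℕ, 1 ≤ k → k + 1 ≤ N →
      xmd k = (1 - 2 / ((k : ℝ) + 1)) • xag k + (2 / ((k : ℝ) + 1)) • xhat k)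
    (hxX : ∀ k : ℕ, 1 ≤ k → k + 1 ≤ N → x (k + 1) ∈ X)
    (hxmin : ∀ k : ℕ, 1 ≤ k → k + 1 ≤ N → ∀ x' ∈ X,
      ⟪f' (xmd k), x (k + 1)⟫
          + (γ * (N : ℝ) / (k : ℝ)) / 2
            * ‖Matrix.toEuclideanLin B (yhat k) - Matrix.toEuclideanLin A (x (k + 1)) - b‖ ^ 2
          + ⟪zhat k, Matrix.toEuclideanLin A (x (k + 1))⟫
          + (2 * L / (α * (k : ℝ))) / 2 * ‖x (k + 1) - xhat k‖ ^ 2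
        ≤ ⟪f' (xmd k), x'⟫
          + (γ * (N : ℝ) / (k : ℝ)) / 2
            * ‖Matrix.toEuclideanLin B (yhat k) - Matrix.toEuclideanLin A x' - b‖ ^ 2
          + ⟪zhat k, Matrix.toEuclideanLin A x'⟫
          + (2 * L / (α * (k : ℝ))) / 2 * ‖x' - xhat k‖ ^ 2)
    (hxhat : ∀ k : ℕ, 1 ≤ k → k + 1 ≤ N →
      xhat (k + 1) = (2 - α) • x (k + 1) + (α - 1) • xhat k)
    (hxag : ∀ k : ℕ, 1 ≤ k → k + 1 ≤ N →
      xag (k + 1) = (1 - 2 / ((k : ℝ) + 1)) • xag k + (2 / ((k : ℝ) + 1)) • x (k + 1))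
    (hyY : ∀ k : ℕ, 1 ≤ k → k + 1 ≤ N → y (k + 1) ∈ Y)
    (hymin : ∀ k : ℕ, 1 ≤ k → k + 1 ≤ N → ∀ y' ∈ Y,
      g (y (k + 1)) - ⟪zhat k, Matrix.toEuclideanLin B (y (k + 1))⟫
          + (γ * (N : ℝ) / (k : ℝ)) / 2
            * ‖Matrix.toEuclideanLin B (y (k + 1)) - Matrix.toEuclideanLin A (x (k + 1)) - b‖ ^ 2
        ≤ g y' - ⟪zhat k, Matrix.toEuclideanLin B y'⟫
          + (γ * (N : ℝ) / (k : ℝ)) / 2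
            * ‖Matrix.toEuclideanLin B y' - Matrix.toEuclideanLin A (x (k + 1)) - b‖ ^ 2)
    (hyhat : ∀ k : ℕ, 1 ≤ k → k + 1 ≤ N →
      yhat (k + 1) = (2 - β) • y (k + 1) + (β - 1) • yhat k)
    (hyag : ∀ k : ℕ, 1 ≤ k → k + 1 ≤ N →
      yag (k + 1) = (1 - 2 / ((k : ℝ) + 1)) • yag k + (2 / ((k : ℝ) + 1)) • y (k + 1))
    (hz : ∀ k : ℕ, 1 ≤ k → k + 1 ≤ N →
      z (k + 1) = zhat k - ((2 - ξ) * γ * (k : ℝ) / (κ * (N : ℝ)))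
        • (Matrix.toEuclideanLin B (y (k + 1)) - Matrix.toEuclideanLin A (x (k + 1)) - b))
    (hzhat : ∀ k : ℕ, 1 ≤ k → k + 1 ≤ N →
      zhat (k + 1) = (1 - κ) • zhat k + κ • z (k + 1))
    (hzag : ∀ k : ℕ, 1 ≤ k → k + 1 ≤ N →
      zag (k + 1) = (1 - 2 / ((k : ℝ) + 1)) • zag k + (2 / ((k : ℝ) + 1)) • z (k + 1)) :
    |(f (xag N) + g (yag N)) - (f xstar + g ystar)|
        ≤ 2 * L * ‖x 1 - xstar‖ ^ 2 / (α * (2 - α) * (N : ℝ) * ((N : ℝ) - 1))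
          + κ * max ((1 + ‖zstar‖) ^ 2) (4 * ‖zstar‖ ^ 2) / (γ * (2 - ξ) * ((N : ℝ) - 1))
          + 2 * γ * ‖Matrix.toEuclideanLin B (y 1) - Matrix.toEuclideanLin B ystar‖ ^ 2
            / ((2 - β) * ((N : ℝ) - 1)) ∧
      ‖Matrix.toEuclideanLin B (yag N) - Matrix.toEuclideanLin A (xag N) - b‖
        ≤ 2 * L * ‖x 1 - xstar‖ ^ 2 / (α * (2 - α) * (N : ℝ) * ((N : ℝ) - 1))
          + κ * max ((1 + ‖zstar‖) ^ 2) (4 * ‖zstar‖ ^ 2) / (γ * (2 - ξ) * ((N : ℝ) - 1))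
          + 2 * γ * ‖Matrix.toEuclideanLin B (y 1) - Matrix.toEuclideanLin B ystar‖ ^ 2
            / ((2 - β) * ((N : ℝ) - 1)) := by
  obtain ⟨hα0, hα1⟩ := hα
  obtain ⟨hξ0, hξ2⟩ := hξ
  have hξp : 0 < ξ := by norm_num at hξ0; linarith
  have hβ1 : β < 2 := by
    rw [hβ, div_lt_iff₀ hξp]; norm_num at hξ0; linarith
  set MA := Matrix.toEuclideanLin A
  set MB := Matrix.toEuclideanLin B
  have hN2 : (2 : ℝ) ≤ N := by exact_mod_cast hN
  have hN0 : (0 : ℝ) < N := by linarith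
  have hκ0 : κ ≠ 0 := by linarith
  have hlyap : ∀ (w : EuclideanSpace ℝ (Fin l)) (k : ℕ), 1 ≤ k → k ≤ N →
      (k : ℝ) * (k - 1) * (f (xag k) + g (yag k) - (f xstar + g ystar)
          - ⟪w, MB (yag k) - MA (xag k) - b⟫)
        + 2 * L / (α * (2 - α)) * ‖xhat k - xstar‖ ^ 2
        + γ * N / (2 - β) * ‖MB (yhat k) - MB ystar‖ ^ 2
        + N / ((2 - ξ) * γ) * ‖zhat k - w‖ ^ 2
      ≤ 2 * L / (α * (2 - α)) * ‖x 1 - xstar‖ ^ 2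
        + γ * N / (2 - β) * ‖MB (y 1) - MB ystar‖ ^ 2 + N / ((2 - ξ) * γ) * ‖w‖ ^ 2 := by
    intro w k hk
    induction k, hk using Nat.le_induction with
    | base =>
      intro _
      rw [← hinitx1, ← hinity1, hinitzhat, zero_sub, norm_neg]
      norm_num
    | succ k hk ih =>
      intro hkN
      have hzk : zhat (k + 1) = zhat k
          - ((2 - ξ) * γ * k / N) • (MB (y (k + 1)) - MA (x (k + 1)) - b) := by
        rw [hzhat k hk hkN, hz k hk hkN, smul_sub, smul_smul,
          show κ * ((2 - ξ) * γ * k / (κ * N)) = (2 - ξ) * γ * k / N by field_simp]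
        module
      have hstep := gladmm_step hXcv hYcv hL hdiff hfconv hgconv hsmooth MA MB hstarX hstarY
        hstarfeas hγ hα0 (by linarith) hξp hξ2 hβ hβ1 (by exact_mod_cast hk)
        (by exact_mod_cast (Nat.le_succ k).trans hkN) w (hmd k hk hkN) (hxX k hk hkN)
        (hxmin k hk hkN) (hxhat k hk hkN) (hxag k hk hkN) (hyY k hk hkN) (hymin k hk hkN)
        (hyhat k hk hkN) (hyag k hk hkN) hzk
      have hcast : ((k + 1 : ℕ) : ℝ) * ((k + 1 : ℕ) - 1) = ((k : ℝ) + 1) * k := by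
        push_cast; ring
      rw [hcast]
      exact hstep.trans (ih ((Nat.le_succ k).trans hkN))
  have hmem : ∀ k : ℕ, 1 ≤ k → k ≤ N → xag k ∈ X ∧ yag k ∈ Y := by
    intro k hk
    induction k, hk using Nat.le_induction with
    | base => exact fun _ => ⟨hinitx2 ▸ hinitX, hinity2 ▸ hinitY⟩
    | succ k hk ih =>
      intro hkN
      obtain ⟨h1, h2⟩ := ih ((Nat.le_succ k).trans hkN)
      have hk1 : (1 : ℝ) ≤ k := by exact_mod_cast hk
      have hθ0 : (0 : ℝ) ≤ 2 / ((k : ℝ) + 1) := by positivity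
      have hθ1 : 0 ≤ 1 - 2 / ((k : ℝ) + 1) := by
        rw [sub_nonneg, div_le_one (by linarith)]; linarith
      rw [hxag k hk hkN, hyag k hk hkN]
      exact ⟨hXcv h1 (hxX k hk hkN) hθ1 hθ0 (by ring), hYcv h2 (hyY k hk hkN) hθ1 hθ0 (by ring)⟩
  obtain ⟨hagX, hagY⟩ := hmem N (by omega) le_rfl
  have hsad := hsaddle _ hagX _ hagY
  have hα2 : 0 < 2 - α := by linarith
  have hβ2 : 0 < 2 - β := by linarith
  have hξ2' : 0 < 2 - ξ := by linarith
  have hN1 : (0 : ℝ) < N - 1 := by linarith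
  have hgap : ∀ w : EuclideanSpace ℝ (Fin l),
      (f (xag N) + g (yag N)) - (f xstar + g ystar) - ⟪w, MB (yag N) - MA (xag N) - b⟫
        ≤ (2 * L * ‖x 1 - xstar‖ ^ 2 / (α * (2 - α) * N * (N - 1))
          + 2 * γ * ‖MB (y 1) - MB ystar‖ ^ 2 / ((2 - β) * (N - 1)))
          + κ / (γ * (2 - ξ) * (N - 1)) * ‖w‖ ^ 2 := by
    intro w
    have h := hlyap w N (by omega) le_rfl
    have hx0 : 0 ≤ 2 * L / (α * (2 - α)) * ‖xhat N - xstar‖ ^ 2 := by positivity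
    have hy0 : 0 ≤ γ * N / (2 - β) * ‖MB (yhat N) - MB ystar‖ ^ 2 := by positivity
    have hz0 : 0 ≤ N / ((2 - ξ) * γ) * ‖zhat N - w‖ ^ 2 := by positivity
    have hNN : (0 : ℝ) < N * (N - 1) := mul_pos hN0 hN1
    refine le_of_mul_le_mul_left ?_ hNN
    have hrhs : (N : ℝ) * (N - 1) * ((2 * L * ‖x 1 - xstar‖ ^ 2 / (α * (2 - α) * N * (N - 1))
          + 2 * γ * ‖MB (y 1) - MB ystar‖ ^ 2 / ((2 - β) * (N - 1)))
          + κ / (γ * (2 - ξ) * (N - 1)) * ‖w‖ ^ 2)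
        = 2 * L / (α * (2 - α)) * ‖x 1 - xstar‖ ^ 2
          + 2 * (γ * N / (2 - β) * ‖MB (y 1) - MB ystar‖ ^ 2)
          + κ * (N / ((2 - ξ) * γ) * ‖w‖ ^ 2) := by
      field_simp
    have hy1 : 0 ≤ γ * N / (2 - β) * ‖MB (y 1) - MB ystar‖ ^ 2 := by positivity
    have hw : N / ((2 - ξ) * γ) * ‖w‖ ^ 2 ≤ κ * (N / ((2 - ξ) * γ) * ‖w‖ ^ 2) :=
      le_mul_of_one_le_left (by positivity) hκ.le
    rw [hrhs]
    linarith
  have hfinal := abs_le_and_norm_le_of_gap_le (zs := zstar) (by positivity)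
    (by linarith) hgap
  rwa [div_mul_eq_mul_div, add_right_comm] at hfinal
end
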